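/- For every t with 1 ≤ t ≤ min(r,d), the images in K[D_t] = K[Z]/I_t(X) of the standard monomials in the minors p(A,B) with |A| = |B| ≤ t−1 (including the empty monomial 1) form a basis of K[D_t] as a K-vector space. -/

import Mathlib

namespace SMB

/-- `geTup f g` : the strictly increasing tuple `f` is `≥` the strictly increasing tuple `g`
in the order on increasing tuples: the length of `f` is at most that of `g`, and `f` is
entrywise `≥` `g` (on the common range of indices). -/
def geTup {N s s' : ℕ} (f : Fin s → Fin N) (g : Fin s' → Fin N) : Prop :=
  ∃ h : s ≤ s', ∀ j : Fin s, g (Fin.castLE h j) ≤ f j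

/-- A strictly increasing `s`-tuple with values in `{1,…,N}` (encoded as `Fin N`). -/
structure IncTup (s N : ℕ) where
  f : Fin s → Fin N
  mono : StrictMono f

/-- A pair of strictly increasing tuples of a common length `s`: row indices in `{1,…,m}`
and column indices in `{1,…,q}`, indexing an `s × s` minor. -/
structure PairIx (m q : ℕ) where
  s : ℕ
  rows : Fin s → Fin m
  cols : Fin s → Fin q
  rmono : StrictMono rows
  cmono : StrictMono cols

/-- The partial order `(A,B) ⪰ (A',B')` on pairs of increasing tuples: `A ≥ A'` and `B ≥ B'`. -/
def PairIx.ge {m q : ℕ} (x y : PairIx m q) : Prop :=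
  geTup x.rows y.rows ∧ geTup x.cols y.cols

end SMB
namespace SMB

variable (K : Type) [Field K] (r d : ℕ)

/-- The polynomial ring `K[Z] = K[x_{ij} : 1 ≤ i ≤ r, 1 ≤ j ≤ d]` in the entries of a
generic `r×d` matrix `X`. -/
abbrev KZ := MvPolynomial (Fin r × Fin d) K

/-- The minor `p(A,B)` of the generic `r×d` matrix `X`, with row indices `A` and column
indices `B` (for the empty pair of tuples this is the constant `1`). -/
noncomputable def minorPoly (x : PairIx r d) : KZ K r d :=
  Matrix.det (Matrix.of fun i j : Fin x.s => MvPolynomial.X (x.rows i, x.cols j))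

/-- The ideal `I_t(X)` of `K[Z]` generated by all `t×t` minors of the generic `r×d` matrix. -/
noncomputable def minorIdeal (t : ℕ) : Ideal (KZ K r d) :=
  Ideal.span {f | ∃ x : PairIx r d, x.s = t ∧ f = minorPoly K r d x}

end SMB

namespace SMB

/-- A sum of unit exponents `u` is lexicographically smaller than another one `u₀` when the two
families agree on a set `S` of indices and the smallest variable off `S` belongs to `u₀` only. -/
lemma toLex_sum_single_lt {κ τ : Type*} [Fintype κ] [LinearOrder τ] (u u₀ : κ → τ)
    (S : κ → Prop) (i₀ : κ)
    (h₁ : ∀ i, S i → u i = u₀ i ∧ u₀ i ≠ u₀ i₀) (h₂ : ∀ i, ¬ S i → u₀ i₀ < u i ∧ u₀ i₀ ≤ u₀ i) :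
    toLex (∑ i, Finsupp.single (u i) 1 : τ →₀ ℕ) < toLex (∑ i, Finsupp.single (u₀ i) 1) := by
  classical
  refine ⟨u₀ i₀, fun v hv => ?_, ?_⟩
  · simp only [ofLex_toLex, Finsupp.finsetSum_apply, Finsupp.single_apply]
    refine Finset.sum_congr rfl fun i _ => ?_
    by_cases hi : S i
    · rw [(h₁ i hi).1]
    · rw [if_neg (hv.trans (h₂ i hi).1).ne', if_neg (hv.trans_le (h₂ i hi).2).ne']
  · simp only [ofLex_toLex, Finsupp.finsetSum_apply, Finsupp.single_apply]
    rw [Finset.sum_eq_zero]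
    · exact Finset.sum_pos' (fun _ _ => Nat.zero_le _) ⟨i₀, Finset.mem_univ _, by simp⟩
    · intro i _
      by_cases hi : S i
      · rw [(h₁ i hi).1, if_neg (h₁ i hi).2]
      · rw [if_neg (h₂ i hi).1.ne']

lemma degree_sum_monomial {τ α K : Type*} [Field K] [DecidableEq α] (m : MonomialOrder τ)
    (S : Finset α) (e : α → τ →₀ ℕ) (c : α → K) (a₀ : α) (ha₀ : a₀ ∈ S) (hc : c a₀ ≠ 0)
    (h : ∀ a ∈ S, a ≠ a₀ → m.toSyn (e a) < m.toSyn (e a₀)) :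
    m.degree (∑ a ∈ S, MvPolynomial.monomial (e a) (c a)) = e a₀ ∧
      ∑ a ∈ S, MvPolynomial.monomial (e a) (c a) ≠ 0 := by
  classical
  set P := ∑ a ∈ S, MvPolynomial.monomial (e a) (c a)
  have hcoeff : P.coeff (e a₀) = c a₀ := by
    simp only [P, MvPolynomial.coeff_sum, MvPolynomial.coeff_monomial]
    rw [Finset.sum_eq_single_of_mem a₀ ha₀]
    · simp
    · intro a ha hne
      rw [if_neg]
      intro heq
      exact (h a ha hne).ne (by rw [heq])
  have hle : m.toSyn (m.degree P) ≤ m.toSyn (e a₀) := by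
    refine m.degree_sum_le.trans (Finset.sup_le fun a ha => m.degree_monomial_le (c a) |>.trans ?_)
    by_cases hne : a = a₀
    · rw [hne]
    · exact (h a ha hne).le
  have hmem : e a₀ ∈ P.support := by rw [MvPolynomial.mem_support_iff, hcoeff]; exact hc
  refine ⟨m.toSyn.injective (hle.antisymm (m.le_degree hmem)), ?_⟩
  rintro h0
  rw [h0] at hcoeff
  exact hc (by simpa using hcoeff.symm)

lemma linearIndependent_of_injective_degree {τ ι K : Type*} [Field K] (m : MonomialOrder τ)
    (P : ι → MvPolynomial τ K) (h0 : ∀ i, P i ≠ 0)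
    (hinj : Function.Injective fun i => m.degree (P i)) : LinearIndependent K P := by
  classical
  rw [linearIndependent_iff']
  intro s g hg
  by_contra! hne
  obtain ⟨i₁, hi₁, hgi₁⟩ := hne
  obtain ⟨i₀, hi₀, hmax⟩ := (s.filter fun i => g i ≠ 0).exists_max_image
    (fun i => m.toSyn (m.degree (P i))) ⟨i₁, by simp [hi₁, hgi₁]⟩
  rw [Finset.mem_filter] at hi₀
  have key := congrArg (MvPolynomial.coeff (m.degree (P i₀))) hg
  rw [MvPolynomial.coeff_sum, Finset.sum_eq_single_of_mem i₀ hi₀.1, MvPolynomial.coeff_smul,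
    MvPolynomial.coeff_zero, smul_eq_mul, mul_eq_zero] at key
  · exact key.elim hi₀.2 (m.leadingCoeff_ne_zero_iff.2 (h0 i₀))
  · intro i hi hii
    by_cases hgi : g i = 0
    · simp [hgi]
    · rw [MvPolynomial.coeff_smul, m.coeff_eq_zero_of_lt, smul_zero]
      refine lt_of_le_of_ne (hmax i (by simp [hi, hgi])) fun heq => hii ?_
      exact hinj (m.toSyn.injective heq)

/-- Expansion of the determinant of a product of rectangular matrices along the rows. -/
lemma det_mul_eq_sum {R κ : Type*} [CommRing R] [Fintype κ] [DecidableEq κ] {s : ℕ}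
    (M : Matrix (Fin s) κ R) (N : Matrix κ (Fin s) R) :
    (M * N).det = ∑ f : Fin s → κ, (∏ i, M i (f i)) * (N.submatrix f id).det := by
  have h : (M * N : Matrix _ _ R) = fun i => ∑ c, M i c • N c := by
    ext i j
    simp [Matrix.mul_apply, Finset.sum_apply]
  have h2 := (Matrix.detRowAlternating (R := R) (n := Fin s)).toMultilinearMap.map_sum
    (fun i c => M i c • N c)
  rw [h]
  refine h2.trans (Finset.sum_congr rfl fun f _ => ?_)
  exact (Matrix.detRowAlternating (R := R) (n := Fin s)).toMultilinearMap.map_smul_univ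
    (fun i => M i (f i)) (fun i => N (f i))

/-- The variables of the polynomial ring in the entries of an `r × n` and an `n × d` matrix. -/
abbrev FactorVar (r n d : ℕ) := (Fin r ×ₗ Fin n) ⊕ₗ (Fin n ×ₗ Fin d)

/-- The entry `(i, c)` of the left factor. -/
def leftVar {r n d : ℕ} (i : Fin r) (c : Fin n) : FactorVar r n d := Sum.inlₗ (toLex (i, c))

/-- The entry `(c, j)` of the right factor. -/
def rightVar {r n d : ℕ} (c : Fin n) (j : Fin d) : FactorVar r n d := Sum.inrₗ (toLex (c, j))

lemma leftVar_lt_leftVar {r n d : ℕ} {i i' : Fin r} {c c' : Fin n} :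
    (leftVar i c : FactorVar r n d) < leftVar i' c' ↔ i < i' ∨ i = i' ∧ c < c' := by
  simp [leftVar, Prod.Lex.lt_iff]

lemma rightVar_lt_rightVar {r n d : ℕ} {c c' : Fin n} {j j' : Fin d} :
    (rightVar c j : FactorVar r n d) < rightVar c' j' ↔ c < c' ∨ c = c' ∧ j < j' := by
  simp [rightVar, Prod.Lex.lt_iff]

lemma leftVar_lt_rightVar {r n d : ℕ} (i : Fin r) (c c' : Fin n) (j : Fin d) :
    (leftVar i c : FactorVar r n d) < rightVar c' j := by
  simp [leftVar, rightVar]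

lemma leftVar_inj {r n d : ℕ} {i i' : Fin r} {c c' : Fin n} :
    (leftVar i c : FactorVar r n d) = leftVar i' c' ↔ i = i' ∧ c = c' := by
  simp [leftVar]

lemma rightVar_inj {r n d : ℕ} {c c' : Fin n} {j j' : Fin d} :
    (rightVar c j : FactorVar r n d) = rightVar c' j' ↔ c = c' ∧ j = j' := by
  simp [rightVar]

/-- Substitution of the product of a generic `r × n` and a generic `n × d` matrix. -/
noncomputable def factorHom (K : Type) [Field K] (r d n : ℕ) :
    KZ K r d →ₐ[K] MvPolynomial (FactorVar r n d) K :=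
  MvPolynomial.aeval fun p =>
    ∑ c, MvPolynomial.X (leftVar p.1 c) * MvPolynomial.X (rightVar c p.2)

lemma factorHom_minorPoly (K : Type) [Field K] (r d n : ℕ) (x : PairIx r d) :
    factorHom K r d n (minorPoly K r d x) =
      ∑ f : Fin x.s → Fin n, (∏ i, MvPolynomial.X (leftVar (x.rows i) (f i))) *
        (Matrix.of fun i j : Fin x.s =>
          (MvPolynomial.X (rightVar (f i) (x.cols j)) : MvPolynomial (FactorVar r n d) K)).det := by
  rw [minorPoly, AlgHom.map_det]
  have := det_mul_eq_sum
    (Matrix.of fun (i : Fin x.s) (c : Fin n) =>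
      (MvPolynomial.X (leftVar (x.rows i) c) : MvPolynomial (FactorVar r n d) K))
    (Matrix.of fun (c : Fin n) (j : Fin x.s) => MvPolynomial.X (rightVar c (x.cols j)))
  refine Eq.trans (congrArg Matrix.det ?_) this
  ext1 i j
  simp [factorHom, Matrix.mul_apply]

lemma factorHom_minorPoly_eq_zero (K : Type) [Field K] (r d n : ℕ) (x : PairIx r d)
    (hx : n < x.s) : factorHom K r d n (minorPoly K r d x) = 0 := by
  rw [factorHom_minorPoly]
  refine Finset.sum_eq_zero fun f _ => ?_
  obtain ⟨i, j, hij, hf⟩ : ∃ i j, i ≠ j ∧ f i = f j :=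
    Fintype.exists_ne_map_eq_of_card_lt f (by simpa using hx)
  rw [Matrix.det_zero_of_row_eq hij, mul_zero]
  ext1 k
  simp [hf]

/-- The exponent of the product of the diagonal entries `(rows i, i)` of the left factor and
`(i, cols i)` of the right factor. -/
noncomputable def diagExp {r d n : ℕ} (x : PairIx r d) (hx : x.s ≤ n) : FactorVar r n d →₀ ℕ :=
  ∑ k : Fin x.s ⊕ Fin x.s, Finsupp.single
    (Sum.elim (fun i => leftVar (x.rows i) (Fin.castLE hx i))
      (fun i => rightVar (Fin.castLE hx i) (x.cols i)) k) 1

lemma exists_first_ne_castLE {s n : ℕ} (h : s ≤ n) {f : Fin s → Fin n}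
    (hf : Function.Injective f) (hne : f ≠ Fin.castLE h) :
    ∃ i₀, (∀ i < i₀, f i = Fin.castLE h i) ∧ Fin.castLE h i₀ < f i₀ := by
  obtain ⟨i₁, hi₁⟩ := Function.ne_iff.1 hne
  obtain ⟨i₀, hi₀, hmin⟩ := wellFounded_lt.has_min {i | f i ≠ Fin.castLE h i} ⟨i₁, hi₁⟩
  have hlt : ∀ i < i₀, f i = Fin.castLE h i := fun i hi => by
    by_contra hc
    exact hmin i hc hi
  refine ⟨i₀, hlt, lt_of_le_of_ne (le_of_not_gt fun hc => ?_) (Ne.symm hi₀)⟩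
  have hval : (f i₀ : ℕ) < i₀ := hc
  have h2 := hlt ⟨f i₀, hval.trans i₀.2⟩ hval
  have h3 := hf (a₁ := ⟨f i₀, hval.trans i₀.2⟩) (a₂ := i₀) (by rw [h2]; ext; simp)
  exact absurd (congrArg Fin.val h3) hval.ne

lemma degree_factorHom_minorPoly (K : Type) [Field K] (r d n : ℕ) (x : PairIx r d)
    (hx : x.s ≤ n) :
    MonomialOrder.lex.degree (factorHom K r d n (minorPoly K r d x)) = diagExp x hx ∧
      factorHom K r d n (minorPoly K r d x) ≠ 0 := by
  classical
  let u : (Fin x.s → Fin n) × Equiv.Perm (Fin x.s) → Fin x.s ⊕ Fin x.s → FactorVar r n d :=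
    fun p => Sum.elim (fun i => leftVar (x.rows i) (p.1 i))
      (fun i => rightVar (p.1 i) (x.cols (p.2 i)))
  let e : (Fin x.s → Fin n) × Equiv.Perm (Fin x.s) → FactorVar r n d →₀ ℕ :=
    fun p => ∑ k, Finsupp.single (u p k) 1
  let c : (Fin x.s → Fin n) × Equiv.Perm (Fin x.s) → K := fun p => ((Equiv.Perm.sign p.2 : ℤ) : K)
  let S : Finset ((Fin x.s → Fin n) × Equiv.Perm (Fin x.s)) :=
    (Finset.univ.filter Function.Injective) ×ˢ Finset.univ
  have hsum : factorHom K r d n (minorPoly K r d x) =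
      ∑ p ∈ S, MvPolynomial.monomial (e p) (c p) := by
    rw [factorHom_minorPoly, Finset.sum_product, Finset.sum_filter]
    refine Finset.sum_congr rfl fun f _ => ?_
    split_ifs with hf
    · rw [← Matrix.det_transpose, Matrix.det_apply', Finset.mul_sum]
      refine Finset.sum_congr rfl fun σ _ => ?_
      have h1 : MvPolynomial.monomial (e (f, σ)) (c (f, σ)) =
          MvPolynomial.C (c (f, σ)) * ∏ k, MvPolynomial.X (u (f, σ) k) := by
        simp only [e, MvPolynomial.X]
        rw [← MvPolynomial.monomial_sum_one, MvPolynomial.C_mul_monomial, mul_one]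
      rw [h1, Fintype.prod_sum_type]
      simp only [u, c, Sum.elim_inl, Sum.elim_inr, Matrix.transpose_apply, Matrix.of_apply,
        map_intCast]
      ring
    · simp only [Function.Injective, not_forall] at hf
      obtain ⟨i, j, hf, hij⟩ := hf
      rw [Matrix.det_zero_of_row_eq hij, mul_zero]
      ext1 k
      simp [hf]
  rw [hsum]
  refine degree_sum_monomial MonomialOrder.lex S e c (Fin.castLE hx, 1)
    (by simp [S, Fin.castLE_injective]) (by simp [c]) ?_
  rintro ⟨f, σ⟩ hmem hne
  have hf : Function.Injective f := by simpa [S] using hmem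
  by_cases hf1 : f = Fin.castLE hx
  · subst hf1
    have hσ : (σ : Fin x.s → Fin x.s) ≠ Fin.castLE le_rfl := fun h => hne (by
      refine Prod.ext rfl (Equiv.ext fun i => ?_)
      simpa using congrFun h i)
    obtain ⟨i₀, hlt, hi₀⟩ := exists_first_ne_castLE le_rfl σ.injective hσ
    refine toLex_sum_single_lt (u (_, σ)) (u (_, 1))
      (Sum.elim (fun _ => True) fun i => i < i₀) (Sum.inr i₀) ?_ ?_
    · rintro (i | i) hi
      · exact ⟨rfl, (leftVar_lt_rightVar _ _ _ _).ne⟩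
      · have h1 : σ i = i := by simpa using hlt i hi
        refine ⟨by simp [u, h1], (rightVar_lt_rightVar.2 (Or.inl ?_)).ne⟩
        simpa using hi
    · rintro (i | i) hi
      · exact absurd trivial hi
      · have hi' : i₀ ≤ i := not_lt.1 hi
        rcases hi'.eq_or_lt with rfl | hi'
        · exact ⟨rightVar_lt_rightVar.2 (Or.inr ⟨rfl, x.cmono (by simpa using hi₀)⟩), le_rfl⟩
        · exact ⟨rightVar_lt_rightVar.2 (Or.inl (by simpa using hi')),
            (rightVar_lt_rightVar.2 (Or.inl (by simpa using hi'))).le⟩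
  · obtain ⟨i₀, hlt, hi₀⟩ := exists_first_ne_castLE hx hf hf1
    refine toLex_sum_single_lt (u (f, σ)) (u (_, 1))
      (Sum.elim (fun i => i < i₀) fun _ => False) (Sum.inl i₀) ?_ ?_
    · rintro (i | i) hi
      · exact ⟨by simp [u, hlt i hi], (leftVar_lt_leftVar.2 (Or.inl (x.rmono hi))).ne⟩
      · exact hi.elim
    · rintro (i | i) hi
      · have hi' : i₀ ≤ i := not_lt.1 hi
        rcases hi'.eq_or_lt with rfl | hi'
        · exact ⟨leftVar_lt_leftVar.2 (Or.inr ⟨rfl, hi₀⟩), le_rfl⟩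
        · exact ⟨leftVar_lt_leftVar.2 (Or.inl (x.rmono hi')),
            (leftVar_lt_leftVar.2 (Or.inl (x.rmono hi'))).le⟩
      · exact ⟨leftVar_lt_rightVar _ _ _ _, (leftVar_lt_rightVar _ _ _ _).le⟩

lemma diagExp_ne_zero {r n d : ℕ} (x : PairIx r d) (hx : x.s ≤ n) (v : FactorVar r n d) :
    diagExp x hx v ≠ 0 ↔ ∃ k, Sum.elim (fun i => leftVar (x.rows i) (Fin.castLE hx i))
      (fun i => rightVar (Fin.castLE hx i) (x.cols i)) k = v := by
  classical
  simp only [diagExp, Finsupp.finsetSum_apply, ne_eq, Finset.sum_eq_zero_iff, Finset.mem_univ,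
    true_implies, Finsupp.single_apply, ite_eq_right_iff, one_ne_zero, imp_false, not_forall,
    not_not]

lemma diagExp_leftVar_ne_zero {r n d : ℕ} (x : PairIx r d) (hx : x.s ≤ n) (a : Fin r)
    (c : Fin n) : diagExp x hx (leftVar a c) ≠ 0 ↔ ∃ h : c < x.s, x.rows ⟨c, h⟩ = a := by
  rw [diagExp_ne_zero]
  constructor
  · rintro ⟨i | i, hi⟩
    · obtain ⟨h1, rfl⟩ := leftVar_inj.1 hi
      exact ⟨i.2, h1⟩
    · exact absurd hi (leftVar_lt_rightVar _ _ _ _).ne'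
  · rintro ⟨h, rfl⟩
    exact ⟨Sum.inl ⟨c, h⟩, rfl⟩

lemma diagExp_rightVar_ne_zero {r n d : ℕ} (x : PairIx r d) (hx : x.s ≤ n) (b : Fin d)
    (c : Fin n) : diagExp x hx (rightVar c b) ≠ 0 ↔ ∃ h : c < x.s, x.cols ⟨c, h⟩ = b := by
  rw [diagExp_ne_zero]
  constructor
  · rintro ⟨i | i, hi⟩
    · exact absurd hi (leftVar_lt_rightVar _ _ _ _).ne
    · obtain ⟨rfl, h1⟩ := rightVar_inj.1 hi
      exact ⟨i.2, h1⟩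
  · rintro ⟨h, rfl⟩
    exact ⟨Sum.inr ⟨c, h⟩, rfl⟩

lemma geTup.trans {N s s' s'' : ℕ} {f : Fin s → Fin N} {g : Fin s' → Fin N}
    {h : Fin s'' → Fin N} (hfg : geTup f g) (hgh : geTup g h) : geTup f h := by
  obtain ⟨h₁, h₂⟩ := hfg
  obtain ⟨h₃, h₄⟩ := hgh
  exact ⟨h₁.trans h₃, fun j => (h₄ (Fin.castLE h₁ j)).trans (h₂ j)⟩

lemma PairIx.ge.trans {m q : ℕ} {x y z : PairIx m q} (h : x.ge y) (h' : y.ge z) : x.ge z :=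
  ⟨h.1.trans h'.1, h.2.trans h'.2⟩

lemma PairIx.ge.antisymm {m q : ℕ} {x y : PairIx m q} (h : x.ge y) (h' : y.ge x) : x = y := by
  obtain ⟨s, a, b, _, _⟩ := x
  obtain ⟨s', a', b', _, _⟩ := y
  obtain ⟨⟨h₁, h₂⟩, ⟨_, h₃⟩⟩ := h
  obtain ⟨⟨h₁', h₂'⟩, ⟨_, h₃'⟩⟩ := h'
  obtain rfl : s = s' := le_antisymm h₁ h₁'
  obtain rfl : a = a' := funext fun i => le_antisymm (h₂' i) (h₂ i)
  obtain rfl : b = b' := funext fun i => le_antisymm (h₃' i) (h₃ i)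
  rfl

/-- The total diagonal exponent of a list of pairs. -/
noncomputable def listExp {r d : ℕ} (n : ℕ) (L : List {x : PairIx r d // 0 < x.s ∧ x.s ≤ n}) :
    FactorVar r n d →₀ ℕ :=
  (L.map fun x => diagExp x.1 x.2.2).sum

lemma listExp_ne_zero {r d n : ℕ} (L : List {x : PairIx r d // 0 < x.s ∧ x.s ≤ n})
    (v : FactorVar r n d) : listExp n L v ≠ 0 ↔ ∃ x ∈ L, diagExp x.1 x.2.2 v ≠ 0 := by
  induction L with
  | nil => simp [listExp]
  | cons x L ih =>
    simp only [listExp, List.map_cons, List.sum_cons, Finsupp.add_apply] at ih ⊢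
    simp [← ih]
    tauto

lemma ge_of_listExp_eq {r d n : ℕ} {x y : {x : PairIx r d // 0 < x.s ∧ x.s ≤ n}}
    {L L' : List {x : PairIx r d // 0 < x.s ∧ x.s ≤ n}} (hy : ∀ z ∈ L', z.1.ge y.1)
    (h : listExp n (x :: L) = listExp n (y :: L')) : x.1.ge y.1 := by
  have hge : ∀ z ∈ y :: L', ∀ (c : ℕ) (hc : c < z.1.s), ∃ hc' : c < y.1.s,
      y.1.rows ⟨c, hc'⟩ ≤ z.1.rows ⟨c, hc⟩ ∧ y.1.cols ⟨c, hc'⟩ ≤ z.1.cols ⟨c, hc⟩ := by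
    intro z hz c hc
    rcases List.mem_cons.1 hz with rfl | hz
    · exact ⟨hc, le_rfl, le_rfl⟩
    · obtain ⟨⟨h₁, h₂⟩, ⟨_, h₃⟩⟩ := hy z hz
      exact ⟨hc.trans_le h₁, h₂ ⟨c, hc⟩, h₃ ⟨c, hc⟩⟩
  have hr : ∀ i : Fin x.1.s, ∃ hc' : (i : ℕ) < y.1.s, y.1.rows ⟨i, hc'⟩ ≤ x.1.rows i := by
    intro i
    have h1 := (listExp_ne_zero (x :: L) (leftVar (x.1.rows i) (Fin.castLE x.2.2 i))).2
      ⟨x, List.mem_cons_self, (diagExp_leftVar_ne_zero _ _ _ _).2 ⟨i.2, rfl⟩⟩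
    rw [h, listExp_ne_zero] at h1
    obtain ⟨z, hz, hz'⟩ := h1
    obtain ⟨hc, hzc⟩ := (diagExp_leftVar_ne_zero _ _ _ _).1 hz'
    obtain ⟨hc', h2, -⟩ := hge z hz _ hc
    exact ⟨hc', h2.trans_eq hzc⟩
  have hc : ∀ i : Fin x.1.s, ∃ hc' : (i : ℕ) < y.1.s, y.1.cols ⟨i, hc'⟩ ≤ x.1.cols i := by
    intro i
    have h1 := (listExp_ne_zero (x :: L) (rightVar (Fin.castLE x.2.2 i) (x.1.cols i))).2
      ⟨x, List.mem_cons_self, (diagExp_rightVar_ne_zero _ _ _ _).2 ⟨i.2, rfl⟩⟩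
    rw [h, listExp_ne_zero] at h1
    obtain ⟨z, hz, hz'⟩ := h1
    obtain ⟨hc, hzc⟩ := (diagExp_rightVar_ne_zero _ _ _ _).1 hz'
    obtain ⟨hc', -, h2⟩ := hge z hz _ hc
    exact ⟨hc', h2.trans_eq hzc⟩
  have hs : x.1.s ≤ y.1.s := by
    by_contra! hlt
    obtain ⟨h', -⟩ := hr ⟨y.1.s, hlt⟩
    exact lt_irrefl _ h'
  exact ⟨⟨hs, fun j => (hr j).2⟩, ⟨hs, fun j => (hc j).2⟩⟩

lemma listExp_injective {r d n : ℕ} (L L' : List {x : PairIx r d // 0 < x.s ∧ x.s ≤ n})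
    (hL : L.Pairwise fun a b => b.1.ge a.1) (hL' : L'.Pairwise fun a b => b.1.ge a.1)
    (h : listExp n L = listExp n L') : L = L' := by
  have hpos : ∀ (x : {x : PairIx r d // 0 < x.s ∧ x.s ≤ n}) (L : List _),
      listExp n (x :: L) ≠ 0 := fun x L h0 => by
    refine (listExp_ne_zero (x :: L) (leftVar (x.1.rows ⟨0, x.2.1⟩)
      (Fin.castLE x.2.2 ⟨0, x.2.1⟩))).2
      ⟨x, List.mem_cons_self, (diagExp_leftVar_ne_zero _ _ _ _).2 ⟨x.2.1, rfl⟩⟩ ?_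
    rw [h0, Finsupp.zero_apply]
  induction L generalizing L' with
  | nil =>
    cases L' with
    | nil => rfl
    | cons y L' => exact absurd h.symm (hpos y L')
  | cons x L ih =>
    cases L' with
    | nil => exact absurd h (hpos x L)
    | cons y L' =>
      rw [List.pairwise_cons] at hL hL'
      obtain rfl : x = y := Subtype.ext
        ((ge_of_listExp_eq hL'.1 h).antisymm (ge_of_listExp_eq hL.1 h.symm))
      rw [ih L' hL.2 hL'.2]
      simpa [listExp] using h

lemma degree_factorHom_prod (K : Type) [Field K] {r d n : ℕ}
    (L : List {x : PairIx r d // 0 < x.s ∧ x.s ≤ n}) :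
    MonomialOrder.lex.degree
        (factorHom K r d n (L.map fun x => minorPoly K r d x.1).prod) = listExp n L ∧
      factorHom K r d n (L.map fun x => minorPoly K r d x.1).prod ≠ 0 := by
  induction L with
  | nil => simp [listExp]
  | cons x L ih =>
    obtain ⟨h1, h2⟩ := degree_factorHom_minorPoly K r d n x.1 x.2.2
    simp only [List.map_cons, List.prod_cons, map_mul]
    refine ⟨?_, mul_ne_zero h2 ih.2⟩
    rw [MonomialOrder.degree_mul h2 ih.2, h1, ih.1]
    simp [listExp]

lemma linearIndependent_standard (K : Type) [Field K] (r d t : ℕ) (ht : 1 ≤ t) :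
    LinearIndependent K
      (fun L : {L : List {x : PairIx r d // 0 < x.s ∧ x.s ≤ t - 1} //
          L.IsChain fun a b => PairIx.ge a.val b.val} =>
        Ideal.Quotient.mk (minorIdeal K r d t)
          ((L.val.map fun x => minorPoly K r d x.val).prod)) := by
  have hker : ∀ a ∈ minorIdeal K r d t, factorHom K r d (t - 1) a = 0 := by
    intro a ha
    have : minorIdeal K r d t ≤ RingHom.ker (factorHom K r d (t - 1)) := by
      refine Ideal.span_le.2 ?_
      rintro _ ⟨x, hx, rfl⟩
      exact factorHom_minorPoly_eq_zero K r d _ x (by omega)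
    exact this ha
  refine LinearIndependent.of_comp
    (Ideal.Quotient.liftₐ (minorIdeal K r d t) (factorHom K r d (t - 1)) hker).toLinearMap ?_
  refine linearIndependent_of_injective_degree MonomialOrder.lex _
    (fun L => (degree_factorHom_prod K L.1).2) fun L L' h => ?_
  have h' : listExp (t - 1) L.1 = listExp (t - 1) L'.1 := by
    rw [← (degree_factorHom_prod K L.1).1, ← (degree_factorHom_prod K L'.1).1]
    exact h
  have hrev : ∀ L : {L : List {x : PairIx r d // 0 < x.s ∧ x.s ≤ t - 1} //
          L.IsChain fun a b => PairIx.ge a.val b.val},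
      L.1.reverse.Pairwise fun a b => b.1.ge a.1 := fun L => by
    have : IsTrans {x : PairIx r d // 0 < x.s ∧ x.s ≤ t - 1} fun a b => a.1.ge b.1 :=
      ⟨fun _ _ _ => PairIx.ge.trans⟩
    exact List.pairwise_reverse.2 (List.isChain_iff_pairwise.1 L.2)
  refine Subtype.ext (List.reverse_injective (listExp_injective _ _ (hrev L) (hrev L') ?_))
  simpa [listExp, List.sum_reverse] using h'

section Straightening

variable {R : Type*} [CommRing R] {r N : ℕ}

/-- The determinant as an alternating map of the rows with indices in `S`, the other rows being
fixed. -/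
def partialDet (S : Fin r → Prop) [DecidablePred S] (z : Fin r → Fin r → R) :
    (Fin r → R) [⋀^{x // S x}]→ₗ[R] R where
  __ := (Matrix.detRowAlternating (R := R) (n := Fin r)).toMultilinearMap.domDomRestrict S
    fun x => z x
  map_eq_zero_of_eq' w i j hij hne := by
    refine (Matrix.detRowAlternating (R := R) (n := Fin r)).map_eq_zero_of_eq _ (i := i.1)
      (j := j.1) ?_ (fun h => hne (Subtype.ext h))
    simp [i.2, j.2, hij]

lemma partialDet_apply (S : Fin r → Prop) [DecidablePred S] (z : Fin r → Fin r → R)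
    (w : {x // S x} → Fin r → R) :
    partialDet S z w = Matrix.det (Matrix.of fun x => if h : S x then w ⟨x, h⟩ else z x) := rfl

/-- The maximal minor with the rows `f` of the `N × r` matrix `v`. -/
def bracket (v : Fin N → Fin r → R) (f : Fin r → Fin N) : R :=
  Matrix.det (Matrix.of fun x => v (f x))

/-- The sum of the entries of a tuple. -/
def weight (f : Fin r → Fin N) : ℕ := ∑ x, (f x : ℕ)

lemma sum_perm_inl_lt {α β : Type*} [Fintype α] [Fintype β] (U : α ⊕ β → ℕ) (c : ℕ)
    (hl : ∀ a, c ≤ U (Sum.inl a)) (hr : ∀ b, U (Sum.inr b) < c) (s : Equiv.Perm (α ⊕ β))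
    (hs : ∃ a b, s (Sum.inl a) = Sum.inr b) :
    ∑ a, U (s (Sum.inl a)) < ∑ a, U (Sum.inl a) := by
  classical
  let A : Finset (α ⊕ β) := Finset.univ.map Function.Embedding.inl
  let B : Finset (α ⊕ β) := A.map s.toEmbedding
  have hA : ∑ a, U (Sum.inl a) = ∑ k ∈ A, U k := by simp [A]
  have hB : ∑ a, U (s (Sum.inl a)) = ∑ k ∈ B, U k := by simp [A, B]
  have hcard : A.card = B.card := by simp [B]
  have hne : (B \ A).Nonempty := by
    obtain ⟨a, b, hab⟩ := hs
    exact ⟨Sum.inr b, Finset.mem_sdiff.2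
      ⟨Finset.mem_map.2 ⟨Sum.inl a, by simp [A], hab⟩, by simp [A]⟩⟩
  rw [hA, hB, ← Finset.sum_sdiff_lt_sum_sdiff]
  calc ∑ k ∈ B \ A, U k < ∑ k ∈ B \ A, c := by
        refine Finset.sum_lt_sum_of_nonempty hne ?_
        rintro (a | b) hk
        · simp [A] at hk
        · exact hr b
    _ = ∑ k ∈ A \ B, c := by
        rw [Finset.sum_const, Finset.sum_const, Finset.card_sdiff_comm hcard]
    _ ≤ ∑ k ∈ A \ B, U k := by
        refine Finset.sum_le_sum ?_
        rintro (a | b) hk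
        · exact hl a
        · simp [A] at hk

lemma weight_dite (S : Fin r → Prop) [DecidablePred S] (g : {x // S x} → Fin N)
    (f : Fin r → Fin N) :
    weight (fun x => if h : S x then g ⟨x, h⟩ else f x) =
      ∑ x, (g x : ℕ) + ∑ x : {x // ¬ S x}, (f x : ℕ) := by
  rw [weight, ← Fintype.sum_subtype_add_sum_subtype S]
  congr 1
  · exact Finset.sum_congr rfl fun x _ => by simp [x.2]
  · exact Finset.sum_congr rfl fun x _ => by simp [x.2]

/-- The quadratic relation obtained by antisymmetrizing a product of two maximal minors over the
`r + 1` rows around a violation `J p < I p`. -/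
lemma bracket_mul_bracket_mem_span (K : Type*) [Field K] [Algebra K R] [IsDomain R]
    (v : Fin N → Fin r → R) (I J : Fin r → Fin N) (hI : Monotone I) (hJ : Monotone J) (p : Fin r)
    (hp : J p < I p) :
    bracket v I * bracket v J ∈ Submodule.span K
      {y | ∃ I' J' : Fin r → Fin N, weight I' < weight I ∧
        weight I' + weight J' = weight I + weight J ∧ y = bracket v I' * bracket v J'} := by
  classical
  set W := Submodule.span K
      {y | ∃ I' J' : Fin r → Fin N, weight I' < weight I ∧
        weight I' + weight J' = weight I + weight J ∧ y = bracket v I' * bracket v J'}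
  let P : Fin r → Prop := fun x => p ≤ x
  let Q : Fin r → Prop := fun x => x ≤ p
  let a := partialDet P (fun x => v (I x))
  let b := partialDet Q (fun x => v (J x))
  let U : {x // P x} ⊕ {x // Q x} → Fin N := Sum.elim (fun x => I x) fun x => J x
  have hzero : (LinearMap.mul' R R).compAlternatingMap (a.domCoprod b) (fun k => v (U k)) = 0 := by
    refine AlternatingMap.map_linearDependent _ _ fun hli => ?_
    have := hli.fintype_card_le_finrank
    simp only [Fintype.card_sum, Module.finrank_fin_fun, P, Q, Fintype.card_subtype] at this
    have h1 : (Finset.univ.filter fun x => p ≤ x).card = r - p := by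
      rw [Finset.filter_le_eq_Ici, Fin.card_Ici]
    have h2 : (Finset.univ.filter fun x => x ≤ p).card = p + 1 := by
      rw [Finset.filter_ge_eq_Iic, Fin.card_Iic]
    omega
  let I' (s : Equiv.Perm ({x // P x} ⊕ {x // Q x})) : Fin r → Fin N :=
    fun x => if h : P x then U (s (Sum.inl ⟨x, h⟩)) else I x
  let J' (s : Equiv.Perm ({x // P x} ⊕ {x // Q x})) : Fin r → Fin N :=
    fun x => if h : Q x then U (s (Sum.inr ⟨x, h⟩)) else J x
  have hterm : ∀ s, LinearMap.mul' R R
      (AlternatingMap.domCoprod.summand a b (Quotient.mk'' s) fun k => v (U k)) =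
        Equiv.Perm.sign s • (bracket v (I' s) * bracket v (J' s)) := by
    intro s
    have h1 : a (fun x => v (U (s (Sum.inl x)))) = bracket v (I' s) := by
      rw [partialDet_apply, bracket]
      congr 2
      funext x
      simp only [I']
      split_ifs <;> rfl
    have h2 : b (fun x => v (U (s (Sum.inr x)))) = bracket v (J' s) := by
      rw [partialDet_apply, bracket]
      congr 2
      funext x
      simp only [J']
      split_ifs <;> rfl
    rw [AlternatingMap.domCoprod.summand_mk'', ← h1, ← h2]
    rcases Int.units_eq_one_or (Equiv.Perm.sign s) with h | h <;> rw [h] <;>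
      simp [Units.neg_smul]
  have hI1 : I' 1 = I := by
    funext x
    simp [I', U]
  have hJ1 : J' 1 = J := by
    funext x
    simp [J', U]
  rw [LinearMap.compAlternatingMap_apply, AlternatingMap.domCoprod_apply, _root_.sum_apply,
    map_sum, ← Finset.add_sum_erase _ (fun σ => LinearMap.mul' R R
      (AlternatingMap.domCoprod.summand a b σ fun k => v (U k)))
      (Finset.mem_univ (Quotient.mk'' 1)), hterm, hI1, hJ1,
    Equiv.Perm.sign_one, one_smul] at hzero
  rw [eq_neg_of_add_eq_zero_left hzero]
  refine W.neg_mem (W.sum_mem fun σ hσ => ?_)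
  obtain ⟨s, rfl⟩ := Quotient.exists_rep σ
  have hs : ∃ x y, s (Sum.inl x) = Sum.inr y := by
    by_contra! hcon
    refine (Finset.mem_erase.1 hσ).1 (Quotient.sound' ?_)
    rw [QuotientGroup.leftRel_apply, mul_one]
    refine inv_mem (Equiv.Perm.mem_sumCongrHom_range_of_perm_mapsTo_inl ?_)
    rintro _ ⟨x, rfl⟩
    rcases hsx : s (Sum.inl x) with y | y
    · exact ⟨y, rfl⟩
    · exact absurd hsx (hcon x y)
  have hmem : bracket v (I' s) * bracket v (J' s) ∈ W := by
    refine Submodule.subset_span ⟨I' s, J' s, ?_, ?_, rfl⟩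
    · have h1 : weight (I' s) = _ := weight_dite P (fun x => U (s (Sum.inl x))) I
      have h2 : weight (I' 1) = _ := weight_dite P (fun x => U (Sum.inl x)) I
      have h3 := sum_perm_inl_lt (fun k => (U k : ℕ)) (I p) (fun x => hI x.2)
        (fun x => lt_of_le_of_lt (hJ x.2) hp) s hs
      rw [hI1] at h2
      rw [h1, h2]
      exact Nat.add_lt_add_right h3 _
    · have h1 : weight (I' s) = _ := weight_dite P (fun x => U (s (Sum.inl x))) I
      have h2 : weight (J' s) = _ := weight_dite Q (fun x => U (s (Sum.inr x))) J
      have h3 : weight (I' 1) = _ := weight_dite P (fun x => U (Sum.inl x)) I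
      have h4 : weight (J' 1) = _ := weight_dite Q (fun x => U (Sum.inr x)) J
      rw [hI1] at h3
      rw [hJ1] at h4
      have h5 := Equiv.sum_comp s fun k => (U k : ℕ)
      rw [Fintype.sum_sum_type, Fintype.sum_sum_type] at h5
      omega
  have := hterm s
  rw [Quotient.mk''_eq_mk] at this
  rw [this]
  rcases Int.units_eq_one_or (Equiv.Perm.sign s) with h | h <;> rw [h]
  · simpa using hmem
  · simpa using hmem

lemma bracket_eq_zero_or_exists_strictMono (v : Fin N → Fin r → R) (f : Fin r → Fin N) :
    bracket v f = 0 ∨ ∃ g : Fin r → Fin N, StrictMono g ∧ weight g = weight f ∧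
      (bracket v f = bracket v g ∨ bracket v f = -bracket v g) := by
  by_cases hf : Function.Injective f
  · right
    have hw : ∑ x, (f (Tuple.sort f x) : ℕ) = ∑ x, (f x : ℕ) :=
      Equiv.sum_comp (Tuple.sort f) fun x => Fin.val (f x)
    refine ⟨f ∘ Tuple.sort f, (Tuple.monotone_sort f).strictMono_of_injective
      (hf.comp (Tuple.sort f).injective),
      hw, ?_⟩
    have h : bracket v (f ∘ Tuple.sort f) =
        ((Equiv.Perm.sign (Tuple.sort f) : ℤ) : R) * bracket v f :=
      Matrix.det_permute (Tuple.sort f) (Matrix.of fun x => v (f x))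
    rcases Int.units_eq_one_or (Equiv.Perm.sign (Tuple.sort f)) with h1 | h1 <;>
      rw [h1] at h <;> simp [h]
  · left
    simp only [Function.Injective, not_forall] at hf
    obtain ⟨i, j, hf, hij⟩ := hf
    refine Matrix.det_zero_of_row_eq hij ?_
    ext1 k
    simp [hf]

lemma weight_le (f : Fin r → Fin N) : weight f ≤ r * N := by
  have := Finset.sum_le_card_nsmul Finset.univ (fun x => (f x : ℕ)) N fun x _ => (f x).2.le
  simpa [weight] using this

/-- The standard products of maximal minors. -/
def standardProducts (v : Fin N → Fin r → R) : Set R :=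
  {y | ∃ L : List {f : Fin r → Fin N // StrictMono f},
    L.Pairwise (fun f g => g.1 ≤ f.1) ∧ y = (L.map fun f => bracket v f.1).prod}

lemma prod_mem_standardProducts (v : Fin N → Fin r → R)
    (M : Multiset {f : Fin r → Fin N // StrictMono f})
    (h : ∀ f ∈ M, ∀ g ∈ M, f.1 ≤ g.1 ∨ g.1 ≤ f.1) :
    (M.map fun f => bracket v f.1).prod ∈ standardProducts v := by
  classical
  let rel : {f : Fin r → Fin N // StrictMono f} → {f : Fin r → Fin N // StrictMono f} → Prop :=
    fun f g => weight g.1 ≤ weight f.1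
  have : Std.Total rel := ⟨fun f g => le_total _ _⟩
  have : IsTrans _ rel := ⟨fun f g h h1 h2 => le_trans h2 h1⟩
  have hperm := List.perm_insertionSort rel M.toList
  refine ⟨M.toList.insertionSort rel, ?_, ?_⟩
  · refine List.Pairwise.imp_of_mem ?_ (List.pairwise_insertionSort rel M.toList)
    intro f g hf hg hfg
    have hf' : f ∈ M := Multiset.mem_toList.1 (hperm.mem_iff.1 hf)
    have hg' : g ∈ M := Multiset.mem_toList.1 (hperm.mem_iff.1 hg)
    rcases h f hf' g hg' with hle | hle
    · have heq := (Finset.sum_eq_sum_iff_of_le (s := Finset.univ)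
        (f := fun x => Fin.val (f.1 x)) (g := fun x => Fin.val (g.1 x)) fun x _ => hle x).1
        (le_antisymm (Finset.sum_le_sum fun x _ => hle x) hfg)
      exact fun x => (heq x (Finset.mem_univ x)).ge
    · exact hle
  · rw [(hperm.map _).prod_eq, ← Multiset.prod_coe, ← Multiset.map_coe, Multiset.coe_toList]

lemma prod_bracket_mem_span (K : Type*) [Field K] [Algebra K R] [IsDomain R]
    (v : Fin N → Fin r → R) (n : ℕ) (M : Multiset {f : Fin r → Fin N // StrictMono f})
    (hn : M.card * (r * N) ^ 2 ≤ (M.map fun f => weight f.1 ^ 2).sum + n) :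
    (M.map fun f => bracket v f.1).prod ∈ Submodule.span K (standardProducts v) := by
  induction n using Nat.strong_induction_on generalizing M with
  | _ n ih =>
  by_cases hM : ∀ f ∈ M, ∀ g ∈ M, f.1 ≤ g.1 ∨ g.1 ≤ f.1
  · exact Submodule.subset_span (prod_mem_standardProducts v M hM)
  · obtain ⟨f, hf, g, hg, hw, hfg⟩ : ∃ f ∈ M, ∃ g ∈ M, weight f.1 ≤ weight g.1 ∧ ¬ f.1 ≤ g.1 := by
      push Not at hM
      obtain ⟨f, hf, g, hg, h1, h2⟩ := hM
      rcases le_total (weight f.1) (weight g.1) with hw | hw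
      · exact ⟨f, hf, g, hg, hw, h1⟩
      · exact ⟨g, hg, f, hf, hw, h2⟩
    obtain ⟨M₁, rfl⟩ := Multiset.exists_cons_of_mem hf
    have hne : g ≠ f := fun h => hfg (by rw [h])
    obtain ⟨M₂, rfl⟩ := Multiset.exists_cons_of_mem ((Multiset.mem_cons.1 hg).resolve_left hne)
    obtain ⟨p, hp⟩ := not_forall.1 hfg
    have hrel := bracket_mul_bracket_mem_span K v f.1 g.1 f.2.monotone g.2.monotone p
      (not_le.1 hp)
    simp only [Multiset.map_cons, Multiset.prod_cons, ← mul_assoc]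
    generalize bracket v f.1 * bracket v g.1 = y at hrel ⊢
    induction hrel using Submodule.span_induction with
    | zero => simp
    | add x y _ _ hx hy => rw [add_mul]; exact add_mem hx hy
    | smul c x _ hx => rw [smul_mul_assoc]; exact Submodule.smul_mem _ c hx
    | mem y hy =>
      obtain ⟨I', J', h1, h2, rfl⟩ := hy
      rcases bracket_eq_zero_or_exists_strictMono v I' with h0 | ⟨I₁, hI₁, hwI, hI⟩
      · simp [h0]
      rcases bracket_eq_zero_or_exists_strictMono v J' with h0 | ⟨J₁, hJ₁, hwJ, hJ⟩
      · simp [h0]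
      have hsq : weight f.1 ^ 2 + weight g.1 ^ 2 < weight I₁ ^ 2 + weight J₁ ^ 2 := by
        rw [hwI, hwJ]
        obtain ⟨k, hk⟩ := Nat.exists_eq_add_of_lt h1
        have hJ' : weight J' = weight g.1 + k + 1 := by omega
        rw [hJ']
        nlinarith
      have hbound : ∀ M : Multiset {f : Fin r → Fin N // StrictMono f},
          (M.map fun f => weight f.1 ^ 2).sum ≤ M.card * (r * N) ^ 2 := fun M => by
        have := Multiset.sum_le_card_nsmul (M.map fun f => weight f.1 ^ 2) ((r * N) ^ 2) (by
          intro x hx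
          obtain ⟨f, -, rfl⟩ := Multiset.mem_map.1 hx
          exact Nat.pow_le_pow_left (weight_le f.1) 2)
        simpa using this
      have hb := hbound (⟨I₁, hI₁⟩ ::ₘ ⟨J₁, hJ₁⟩ ::ₘ M₂)
      simp only [Multiset.map_cons, Multiset.sum_cons, Multiset.card_cons] at hn hb
      have hmem := ih (n - (weight I₁ ^ 2 + weight J₁ ^ 2 - (weight f.1 ^ 2 + weight g.1 ^ 2)))
        (by omega) (⟨I₁, hI₁⟩ ::ₘ ⟨J₁, hJ₁⟩ ::ₘ M₂)
        (by simp only [Multiset.map_cons, Multiset.sum_cons, Multiset.card_cons]; omega)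
      simp only [Multiset.map_cons, Multiset.prod_cons, ← mul_assoc] at hmem
      rcases hI with hI | hI <;> rcases hJ with hJ | hJ <;> rw [hI, hJ] <;> simpa using hmem

lemma adjoin_bracket_le_span (K : Type*) [Field K] [Algebra K R] [IsDomain R]
    (v : Fin N → Fin r → R) :
    Subalgebra.toSubmodule (Algebra.adjoin K (Set.range (bracket v))) ≤
      Submodule.span K (standardProducts v) := by
  rw [Algebra.adjoin_eq_span]
  refine Submodule.span_le.2 fun y hy => ?_
  obtain h0 | ⟨M, h⟩ : y = 0 ∨ ∃ M : Multiset {f : Fin r → Fin N // StrictMono f},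
      y = (M.map fun f => bracket v f.1).prod ∨ y = -(M.map fun f => bracket v f.1).prod := by
    induction hy using Submonoid.closure_induction with
    | one => exact Or.inr ⟨0, by simp⟩
    | mem y hy =>
      obtain ⟨f, rfl⟩ := hy
      rcases bracket_eq_zero_or_exists_strictMono v f with h0 | ⟨g, hg, -, h⟩
      · exact Or.inl h0
      · exact Or.inr ⟨{⟨g, hg⟩}, by simpa using h⟩
    | mul x y _ _ hx hy =>
      rcases hx with rfl | ⟨M, hM⟩
      · simp
      rcases hy with rfl | ⟨M', hM'⟩
      · simp
      refine Or.inr ⟨M + M', ?_⟩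
      rcases hM with rfl | rfl <;> rcases hM' with rfl | rfl <;> simp
  · simp [h0]
  · have := prod_bracket_mem_span K v _ M le_add_self
    rcases h with rfl | rfl
    · exact this
    · exact neg_mem this

end Straightening

lemma geTup_orderEmbOfFin {N s s' : ℕ} {A A' : Finset (Fin N)} (h : A.card = s)
    (h' : A'.card = s') (hcount : ∀ m : ℕ, m ≤ N →
      (A.filter fun a : Fin N => (a : ℕ) < m).card ≤
        (A'.filter fun a : Fin N => (a : ℕ) < m).card) :
    geTup (A.orderEmbOfFin h) (A'.orderEmbOfFin h') := by
  have hs : s ≤ s' := by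
    have := hcount N le_rfl
    rwa [Finset.filter_true_of_mem fun a _ => a.2, Finset.filter_true_of_mem fun a _ => a.2,
      h, h'] at this
  refine ⟨hs, fun j => ?_⟩
  by_contra! hlt
  have h1 := hcount (A.orderEmbOfFin h j + 1) (A.orderEmbOfFin h j).2
  have h2 : (j : ℕ) + 1 ≤ (A.filter fun a : Fin N => (a : ℕ) < A.orderEmbOfFin h j + 1).card := by
    rw [← Fin.card_Iic, ← Finset.card_map (A.orderEmbOfFin h).toEmbedding]
    refine Finset.card_le_card fun a ha => ?_
    obtain ⟨i, hi, rfl⟩ := Finset.mem_map.1 ha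
    refine Finset.mem_filter.2 ⟨Finset.orderEmbOfFin_mem A h i, Nat.lt_succ_of_le ?_⟩
    exact (A.orderEmbOfFin h).monotone (Finset.mem_Iic.1 hi)
  have h3 : (A'.filter fun a : Fin N => (a : ℕ) < A.orderEmbOfFin h j + 1).card ≤ (j : ℕ) := by
    have : (j : ℕ) = (Finset.Iio (Fin.castLE hs j)).card := by simp
    rw [this, ← Finset.card_map (A'.orderEmbOfFin h').toEmbedding]
    refine Finset.card_le_card fun a ha => ?_
    obtain ⟨ha, ham⟩ := Finset.mem_filter.1 ha
    have hr : a ∈ Set.range (A'.orderEmbOfFin h') := by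
      rw [Finset.range_orderEmbOfFin]
      exact ha
    obtain ⟨i, rfl⟩ := hr
    refine Finset.mem_map.2 ⟨i, Finset.mem_Iio.2 ?_, rfl⟩
    rw [← (A'.orderEmbOfFin h').lt_iff_lt]
    exact lt_of_le_of_lt (Nat.le_of_lt_succ ham) hlt
  omega

lemma det_submatrix_eq_or_neg {R m n : Type*} [CommRing R] [Fintype m] [DecidableEq m]
    [Fintype n] [DecidableEq n] (M : Matrix n n R) (e₁ e₂ : m ≃ n) :
    M.det = (M.submatrix e₁ e₂).det ∨ M.det = -(M.submatrix e₁ e₂).det := by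
  have h : M.submatrix e₁ e₂ = (M.submatrix (e₂.symm.trans e₁) id).submatrix e₂ e₂ := by
    ext1 i j
    simp
  rw [h, Matrix.det_submatrix_equiv_self, Matrix.det_permute]
  rcases Int.units_eq_one_or (Equiv.Perm.sign (e₂.symm.trans e₁)) with h | h <;> rw [h] <;> simp

variable {r d : ℕ}

/-- The rows of the generic matrix that are not hit by the unit columns among `f`. -/
def rowSet (f : Fin r → Fin (d + r)) : Finset (Fin r) :=
  Finset.univ.filter fun i => ∀ x, f x ≠ Fin.natAdd d i.rev

/-- The columns of the generic matrix among `f`. -/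
def colSet (f : Fin r → Fin (d + r)) : Finset (Fin d) :=
  Finset.univ.filter fun j => ∃ x, f x = Fin.castAdd r j

lemma mem_rowSet {f : Fin r → Fin (d + r)} {i : Fin r} :
    i ∈ rowSet f ↔ ∀ x, f x ≠ Fin.natAdd d i.rev := by simp [rowSet]

lemma mem_colSet {f : Fin r → Fin (d + r)} {j : Fin d} :
    j ∈ colSet f ↔ ∃ x, f x = Fin.castAdd r j := by simp [colSet]

lemma exists_equiv_positions {f : Fin r → Fin (d + r)} (hf : Function.Injective f) :
    ∃ e : {j // j ∈ colSet f} ⊕ {i // i ∉ rowSet f} ≃ Fin r,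
      (∀ j, f (e (Sum.inl j)) = Fin.castAdd r j.1) ∧
        ∀ i, f (e (Sum.inr i)) = Fin.natAdd d i.1.rev := by
  have h₁ : ∀ j : {j // j ∈ colSet f}, ∃ x, f x = Fin.castAdd r j.1 := fun j => mem_colSet.1 j.2
  have h₂ : ∀ i : {i // i ∉ rowSet f}, ∃ x, f x = Fin.natAdd d i.1.rev := fun i => by
    simpa [mem_rowSet] using i.2
  choose g₁ hg₁ using h₁
  choose g₂ hg₂ using h₂
  refine ⟨Equiv.ofBijective (Sum.elim g₁ g₂) ⟨?_, fun x => ?_⟩, hg₁, hg₂⟩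
  · rintro (j | i) (j' | i') h
    · have := congrArg f h
      simp only [Sum.elim_inl, hg₁] at this
      rw [Subtype.ext (Fin.castAdd_injective _ _ this)]
    · have := congrArg (fun x => (f x : ℕ)) h
      simp only [Sum.elim_inl, Sum.elim_inr, hg₁, hg₂, Fin.val_castAdd, Fin.val_natAdd] at this
      omega
    · have := congrArg (fun x => (f x : ℕ)) h
      simp only [Sum.elim_inl, Sum.elim_inr, hg₁, hg₂, Fin.val_castAdd, Fin.val_natAdd] at this
      omega
    · have := congrArg f h
      simp only [Sum.elim_inr, hg₂] at this
      rw [Subtype.ext (Fin.rev_injective (Fin.natAdd_injective _ _ this))]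
  · obtain ⟨j, hx⟩ | ⟨k, hx⟩ :
        (∃ j, f x = Fin.castAdd r j) ∨ ∃ k, f x = Fin.natAdd d k := by
      induction f x using Fin.addCases with
      | left j => exact Or.inl ⟨j, rfl⟩
      | right k => exact Or.inr ⟨k, rfl⟩
    · refine ⟨Sum.inl ⟨j, mem_colSet.2 ⟨x, hx⟩⟩, hf ?_⟩
      rw [hx]
      exact hg₁ _
    · refine ⟨Sum.inr ⟨k.rev, fun h => mem_rowSet.1 h x (by simpa using hx)⟩, hf ?_⟩
      exact (hg₂ _).trans (by rw [Fin.rev_rev, hx])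

lemma card_colSet {f : Fin r → Fin (d + r)} (hf : Function.Injective f) :
    (colSet f).card = (rowSet f).card := by
  obtain ⟨e, -⟩ := exists_equiv_positions hf
  have h := Fintype.card_congr e
  rw [Fintype.card_sum, Fintype.card_coe, Fintype.card_subtype_compl, Fintype.card_coe,
    Fintype.card_fin] at h
  have := card_finset_fin_le (rowSet f)
  omega

/-- The minor of the generic matrix that a maximal minor of the extended matrix equals up to
sign. -/
def toPair (f : {f : Fin r → Fin (d + r) // StrictMono f}) : PairIx r d where
  s := (rowSet f.1).card
  rows := (rowSet f.1).orderEmbOfFin rfl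
  cols := (colSet f.1).orderEmbOfFin (card_colSet f.2.injective)
  rmono := ((rowSet f.1).orderEmbOfFin rfl).strictMono
  cmono := ((colSet f.1).orderEmbOfFin (card_colSet f.2.injective)).strictMono

lemma card_colSet_filter {f : Fin r → Fin (d + r)} (hf : Function.Injective f) {m : ℕ}
    (hm : m ≤ d) : ((colSet f).filter fun j : Fin d => (j : ℕ) < m).card =
      (Finset.univ.filter fun x => (f x : ℕ) < m).card := by
  rw [← Finset.card_image_of_injective _ (Fin.castAdd_injective d r),
    ← Finset.card_image_of_injective (Finset.univ.filter fun x => (f x : ℕ) < m) hf]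
  congr 1
  ext c
  simp only [Finset.mem_image, Finset.mem_filter, mem_colSet, Finset.mem_univ, true_and]
  constructor
  · rintro ⟨j, ⟨⟨x, hx⟩, hj⟩, rfl⟩
    exact ⟨x, by simpa [hx] using hj, hx⟩
  · rintro ⟨x, hx, rfl⟩
    refine ⟨⟨f x, hx.trans_le hm⟩, ⟨⟨x, ?_⟩, hx⟩, ?_⟩ <;> ext <;> simp

lemma card_rowSet_filter {f : Fin r → Fin (d + r)} (hf : Function.Injective f) {m : ℕ}
    (hm : m ≤ r) : ((rowSet f).filter fun i : Fin r => (i : ℕ) < m).card +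
      (Finset.univ.filter fun x => d + r ≤ f x + m).card = m := by
  have h : ((Finset.univ.filter fun i : Fin r => i ∉ rowSet f).filter
      fun i : Fin r => (i : ℕ) < m).card = (Finset.univ.filter fun x => d + r ≤ f x + m).card := by
    rw [← Finset.card_image_of_injective _
        ((Fin.natAdd_injective r d).comp Fin.rev_injective),
      ← Finset.card_image_of_injective (Finset.univ.filter fun x => d + r ≤ f x + m) hf]
    congr 1
    ext c
    simp only [Finset.mem_image, Finset.mem_filter, mem_rowSet, Finset.mem_univ, true_and,
      not_forall, not_not, Function.comp_apply]
    constructor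
    · rintro ⟨i, ⟨⟨x, hx⟩, hi⟩, rfl⟩
      refine ⟨x, ?_, hx⟩
      rw [hx, Fin.val_natAdd, Fin.val_rev]
      omega
    · rintro ⟨x, hx, rfl⟩
      have hlt := (f x).2
      have heq : Fin.natAdd d (Fin.rev ⟨d + r - 1 - f x, by omega⟩ : Fin r) = f x := by
        ext
        rw [Fin.val_natAdd, Fin.val_rev]
        dsimp only
        omega
      exact ⟨⟨d + r - 1 - f x, by omega⟩, ⟨⟨x, heq.symm⟩, by dsimp only; omega⟩, heq⟩
  have h2 : (Finset.univ.filter fun i : Fin r => (i : ℕ) < m).card = m := by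
    rw [Fin.card_filter_val_lt]
    omega
  have h3 : ((rowSet f).filter fun i : Fin r => (i : ℕ) < m) =
      (Finset.univ.filter fun i : Fin r => (i : ℕ) < m).filter fun i => i ∈ rowSet f := by
    ext
    simp [and_comm]
  have h4 : ((Finset.univ.filter fun i : Fin r => i ∉ rowSet f).filter fun i : Fin r => (i : ℕ) < m) =
      (Finset.univ.filter fun i : Fin r => (i : ℕ) < m).filter fun i => i ∉ rowSet f := by
    ext
    simp [and_comm]
  rw [← h, h3, h4, Finset.card_filter_add_card_filter_not, h2]

lemma toPair_ge {f g : {f : Fin r → Fin (d + r) // StrictMono f}} (h : g.1 ≤ f.1) :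
    (toPair f).ge (toPair g) := by
  constructor
  · refine geTup_orderEmbOfFin _ _ fun m hm => ?_
    have h1 := card_rowSet_filter f.2.injective hm
    have h2 := card_rowSet_filter g.2.injective hm
    have h3 : (Finset.univ.filter fun x => d + r ≤ g.1 x + m).card ≤
        (Finset.univ.filter fun x => d + r ≤ f.1 x + m).card :=
      Finset.card_le_card fun x hx => by
        have : (g.1 x : ℕ) ≤ f.1 x := h x
        simp only [Finset.mem_filter, Finset.mem_univ, true_and] at hx ⊢
        omega
    omega
  · refine geTup_orderEmbOfFin _ _ fun m hm => ?_
    rw [card_colSet_filter f.2.injective hm, card_colSet_filter g.2.injective hm]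
    refine Finset.card_le_card fun x hx => ?_
    have : (g.1 x : ℕ) ≤ f.1 x := h x
    simp only [Finset.mem_filter, Finset.mem_univ, true_and] at hx ⊢
    omega

variable (K : Type) [Field K]

/-- The columns of the generic matrix, followed by the unit vectors in reverse order. -/
noncomputable def extendedColumns (r d : ℕ) : Fin (d + r) → Fin r → KZ K r d :=
  fun c i => Fin.addCases (fun j => MvPolynomial.X (i, j)) (fun k => if i = k.rev then 1 else 0) c

lemma bracket_extendedColumns (f : {f : Fin r → Fin (d + r) // StrictMono f}) :
    bracket (extendedColumns K r d) f.1 = minorPoly K r d (toPair f) ∨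
      bracket (extendedColumns K r d) f.1 = -minorPoly K r d (toPair f) := by
  obtain ⟨e, he₁, he₂⟩ := exists_equiv_positions f.2.injective
  let eB := (colSet f.1).orderIsoOfFin (card_colSet f.2.injective)
  let eA := (rowSet f.1).orderIsoOfFin rfl
  let e₁ := (Equiv.sumCongr eB.toEquiv (Equiv.refl {i // i ∉ rowSet f.1})).trans e
  let e₂ := (Equiv.sumCongr eA.toEquiv (Equiv.refl {i // i ∉ rowSet f.1})).trans
    (Equiv.sumCompl fun i => i ∈ rowSet f.1)
  let M : Matrix (Fin r) (Fin r) (KZ K r d) := Matrix.of fun x => extendedColumns K r d (f.1 x)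
  have hblock : M.submatrix e₁ e₂ = Matrix.fromBlocks
      (Matrix.of fun i j : Fin (rowSet f.1).card =>
        (MvPolynomial.X ((toPair f).rows i, (toPair f).cols j) : KZ K r d)).transpose
      (Matrix.of fun (i : Fin (rowSet f.1).card) (j : {i // i ∉ rowSet f.1}) =>
        M (e₁ (Sum.inl i)) (e₂ (Sum.inr j))) 0 1 := by
    ext1 (i | i) (j | j)
    · change extendedColumns K r d (f.1 (e (Sum.inl (eB i)))) (eA j) = _
      rw [he₁, extendedColumns, Fin.addCases_left]
      rfl
    · rfl
    · change extendedColumns K r d (f.1 (e (Sum.inr i))) (eA j) = 0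
      rw [he₂, extendedColumns, Fin.addCases_right, Fin.rev_rev, if_neg]
      intro h
      exact i.2 (h ▸ (eA j).2)
    · change extendedColumns K r d (f.1 (e (Sum.inr i))) j = (1 : Matrix _ _ _) i j
      rw [he₂, extendedColumns, Fin.addCases_right, Fin.rev_rev, Matrix.one_apply]
      simp only [Subtype.ext_iff, eq_comm]
  have hdet : (M.submatrix e₁ e₂).det = minorPoly K r d (toPair f) := by
    rw [hblock, Matrix.det_fromBlocks_zero₂₁, Matrix.det_one, mul_one, Matrix.det_transpose]
    rfl
  rw [← hdet]
  exact det_submatrix_eq_or_neg M e₁ e₂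

lemma X_mem_range_bracket (i : Fin r) (j : Fin d) :
    (MvPolynomial.X (i, j) : KZ K r d) ∈ Set.range (bracket (extendedColumns K r d)) := by
  refine ⟨fun x => if x = i then Fin.castAdd r j else Fin.natAdd d x.rev, ?_⟩
  have h : (Matrix.of fun x => extendedColumns K r d
      ((fun x => if x = i then Fin.castAdd r j else Fin.natAdd d x.rev) x)) =
      (1 : Matrix (Fin r) (Fin r) (KZ K r d)).updateRow i fun k => MvPolynomial.X (k, j) := by
    ext1 x k
    by_cases hx : x = i
    · subst hx
      simp [extendedColumns]
    · rw [Matrix.of_apply, Matrix.updateRow_ne hx]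
      simp only [if_neg hx, extendedColumns, Fin.addCases_right, Fin.rev_rev, Matrix.one_apply]
      simp only [eq_comm]
  rw [bracket, h, ← Matrix.cramer_transpose_apply, Matrix.transpose_one, Matrix.cramer_one]
  rfl

lemma span_standardProducts_extendedColumns (r d : ℕ) :
    Submodule.span K (standardProducts (extendedColumns K r d)) = ⊤ := by
  rw [eq_top_iff]
  refine le_trans ?_ (adjoin_bracket_le_span K (extendedColumns K r d))
  have : Algebra.adjoin K (Set.range (bracket (extendedColumns K r d))) = ⊤ := by
    rw [eq_top_iff, ← MvPolynomial.adjoin_range_X]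
    refine Algebra.adjoin_mono ?_
    rintro _ ⟨⟨i, j⟩, rfl⟩
    exact X_mem_range_bracket K i j
  rw [this, Algebra.top_toSubmodule]

lemma minorPoly_mem_minorIdeal {t : ℕ} (x : PairIx r d) (hx : t ≤ x.s) :
    minorPoly K r d x ∈ minorIdeal K r d t := by
  obtain ⟨s, a, b, ha, hb⟩ := x
  change t ≤ s at hx
  induction s, hx using Nat.le_induction with
  | base => exact Ideal.subset_span ⟨_, rfl, rfl⟩
  | succ s _ ih =>
    rw [minorPoly, Matrix.det_succ_row_zero]
    refine Ideal.sum_mem _ fun j _ => Ideal.mul_mem_left _ _ ?_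
    exact ih (a ∘ Fin.succ) (b ∘ j.succAbove) (ha.comp (Fin.strictMono_succ))
      (hb.comp (Fin.strictMono_succAbove j))

lemma exists_standard_list (n : ℕ) (L : List (PairIx r d))
    (hL : L.Pairwise fun x y => x.ge y) (hs : ∀ x ∈ L, x.s ≤ n) :
    ∃ L' : List {x : PairIx r d // 0 < x.s ∧ x.s ≤ n},
      L'.Pairwise (fun a b => PairIx.ge a.val b.val) ∧ (∀ y ∈ L', y.1 ∈ L) ∧
        (L'.map fun x => minorPoly K r d x.1).prod = (L.map (minorPoly K r d)).prod := by
  induction L with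
  | nil => exact ⟨[], by simp⟩
  | cons x L ih =>
    rw [List.pairwise_cons] at hL
    obtain ⟨L', h₁, h₂, h₃⟩ := ih hL.2 fun y hy => hs y (List.mem_cons_of_mem _ hy)
    rcases Nat.eq_zero_or_pos x.s with h0 | h0
    · refine ⟨L', h₁, fun y hy => List.mem_cons_of_mem _ (h₂ y hy), ?_⟩
      have : minorPoly K r d x = 1 := by
        obtain ⟨s, a, b, _, _⟩ := x
        obtain rfl : s = 0 := h0
        exact Matrix.det_fin_zero
      rw [h₃, List.map_cons, List.prod_cons, this, one_mul]
    · refine ⟨⟨x, h0, hs x List.mem_cons_self⟩ :: L', ?_, ?_, ?_⟩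
      · exact List.pairwise_cons.2 ⟨fun y hy => hL.1 _ (h₂ y hy), h₁⟩
      · simpa using fun y hy hy' hmem => Or.inr (h₂ ⟨y, hy, hy'⟩ hmem)
      · rw [List.map_cons, List.prod_cons, List.map_cons, List.prod_cons, h₃]

lemma mk_standardProduct_mem_span {t : ℕ} (ht : 1 ≤ t) {y : KZ K r d}
    (hy : y ∈ standardProducts (extendedColumns K r d)) :
    Ideal.Quotient.mk (minorIdeal K r d t) y ∈ Submodule.span K
      (Set.range (fun L : {L : List {x : PairIx r d // 0 < x.s ∧ x.s ≤ t - 1} //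
          L.IsChain fun a b => PairIx.ge a.val b.val} =>
        Ideal.Quotient.mk (minorIdeal K r d t)
          ((L.val.map fun x => minorPoly K r d x.val).prod))) := by
  obtain ⟨L, hL, rfl⟩ := hy
  have hsign : (L.map fun f => bracket (extendedColumns K r d) f.1).prod =
      ((L.map toPair).map (minorPoly K r d)).prod ∨
      (L.map fun f => bracket (extendedColumns K r d) f.1).prod =
        -((L.map toPair).map (minorPoly K r d)).prod := by
    clear hL
    induction L with
    | nil => simp
    | cons f L ih =>
      simp only [List.map_cons, List.prod_cons]
      rcases ih with ih | ih <;> rcases bracket_extendedColumns K f with h | h <;>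
        rw [ih, h] <;> simp
  suffices h : Ideal.Quotient.mk (minorIdeal K r d t)
      ((L.map toPair).map (minorPoly K r d)).prod ∈ Submodule.span K
      (Set.range (fun L : {L : List {x : PairIx r d // 0 < x.s ∧ x.s ≤ t - 1} //
          L.IsChain fun a b => PairIx.ge a.val b.val} =>
        Ideal.Quotient.mk (minorIdeal K r d t)
          ((L.val.map fun x => minorPoly K r d x.val).prod))) by
    rcases hsign with h' | h' <;> rw [h']
    · exact h
    · rw [map_neg]
      exact neg_mem h
  by_cases hs : ∀ x ∈ L.map toPair, x.s ≤ t - 1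
  · obtain ⟨L', h₁, -, h₃⟩ := exists_standard_list K (t - 1) (L.map toPair)
      (List.pairwise_map.2 (hL.imp toPair_ge)) hs
    rw [← h₃]
    exact Submodule.subset_span ⟨⟨L', h₁.isChain⟩, rfl⟩
  · push Not at hs
    obtain ⟨x, hx, hxs⟩ := hs
    have hmem : ((L.map toPair).map (minorPoly K r d)).prod ∈ minorIdeal K r d t :=
      Ideal.mem_of_dvd _ (List.dvd_prod (List.mem_map_of_mem hx))
        (minorPoly_mem_minorIdeal K x (by omega))
    rw [Ideal.Quotient.eq_zero_iff_mem.2 hmem]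
    exact zero_mem _

lemma span_standard (r d t : ℕ) (ht : 1 ≤ t) :
    Submodule.span K
      (Set.range (fun L : {L : List {x : PairIx r d // 0 < x.s ∧ x.s ≤ t - 1} //
          L.IsChain fun a b => PairIx.ge a.val b.val} =>
        Ideal.Quotient.mk (minorIdeal K r d t)
          ((L.val.map fun x => minorPoly K r d x.val).prod))) = ⊤ := by
  rw [eq_top_iff]
  rintro y -
  obtain ⟨p, rfl⟩ := Ideal.Quotient.mk_surjective y
  have hp : p ∈ Submodule.span K (standardProducts (extendedColumns K r d)) := by
    rw [span_standardProducts_extendedColumns]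
    trivial
  induction hp using Submodule.span_induction with
  | mem p hp => exact mk_standardProduct_mem_span K ht hp
  | zero => simp
  | add p q _ _ hp hq => rw [map_add]; exact add_mem hp hq
  | smul c p _ hp => exact Submodule.smul_mem _ c hp

end SMB

open SMB in
/-- **Standard monomial basis for the determinantal variety `D_t`.**
For `1 ≤ t ≤ min(r,d)`, the images in `K[D_t] = K[Z]/I_t(X)` of the standard monomials in
the minors `p(A,B)` with `1 ≤ |A| = |B| ≤ t-1` (products over weakly decreasing chains, the
empty product being `1`) are linearly independent over `K` and span `K[D_t]`; that is,
they form a `K`-basis of `K[D_t]`. -/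
theorem determinantal_standard_monomial_basis (K : Type) [Field K] [IsAlgClosed K]
    (r d t : ℕ) (ht : 1 ≤ t) (htr : t ≤ r) (htd : t ≤ d) :
    LinearIndependent K
      (fun L : {L : List {x : PairIx r d // 0 < x.s ∧ x.s ≤ t - 1} //
          L.Chain' fun a b => PairIx.ge a.val b.val} =>
        Ideal.Quotient.mk (minorIdeal K r d t)
          ((L.val.map fun x => minorPoly K r d x.val).prod)) ∧
    Submodule.span K
      (Set.range (fun L : {L : List {x : PairIx r d // 0 < x.s ∧ x.s ≤ t - 1} //
          L.Chain' fun a b => PairIx.ge a.val b.val} =>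
        Ideal.Quotient.mk (minorIdeal K r d t)
          ((L.val.map fun x => minorPoly K r d x.val).prod))) = ⊤ := by
  exact ⟨linearIndependent_standard K r d t ht, span_standard K r d t ht⟩
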